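/- Let n ≥ 3, let φ : ℝ^{n−1}₊ → ℝ₊ be twice continuously differentiable, let F : ℝ₊ → ℝ be twice continuously differentiable, and define f : ℝⁿ₊ → ℝ by f(x₁,…,xₙ) = F( x₁ · φ(x₂/x₁, …, xₙ/x₁) ). Then at every point x ∈ ℝⁿ₊, writing u = (x₂/x₁, …, xₙ/x₁) and w = x₁·φ(u), one has the identity x₁^{n−1} · det(f_ij)(x) = φ(u)² · (F′(w))^{n−1} · F″(w) · det(φ_ij)(u), where det(f_ij) is the n×n Hessian determinant of f and det(φ_ij) is the (n−1)×(n−1) Hessian determinant of φ. -/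

import Mathlib

open Real

/-- Partial derivative of `f` in the `i`-th coordinate direction. -/
noncomputable def pd {n : ℕ} (i : Fin n) (f : (Fin n → ℝ) → ℝ) (x : Fin n → ℝ) : ℝ :=
  fderiv ℝ f x (Pi.single i 1)

/-- Hessian matrix of second partial derivatives of `f` at `x`. -/
noncomputable def hess {n : ℕ} (f : (Fin n → ℝ) → ℝ) (x : Fin n → ℝ) :
    Matrix (Fin n) (Fin n) ℝ :=
  fun i j => pd i (pd j f) x

/-- Hessian determinant `det(f_ij)` of `f` at `x`. -/
noncomputable def hessDet {n : ℕ} (f : (Fin n → ℝ) → ℝ) (x : Fin n → ℝ) : ℝ :=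
  (hess f x).det

/-- The open positive orthant `ℝⁿ₊`. -/
def posOrth (n : ℕ) : Set (Fin n → ℝ) := {x | ∀ i, 0 < x i}

/-- `f` is differentiable at `x` with partial derivatives `a`. -/
def HasPD {n : ℕ} (f : (Fin n → ℝ) → ℝ) (x : Fin n → ℝ) (a : Fin n → ℝ) : Prop :=
  DifferentiableAt ℝ f x ∧ ∀ i, pd i f x = a i

lemma HasPD.of {n : ℕ} {f : (Fin n → ℝ) → ℝ} {x : Fin n → ℝ} {L : (Fin n → ℝ) →L[ℝ] ℝ}
    (h : HasFDerivAt f L x) {a : Fin n → ℝ} (ha : ∀ i, L (Pi.single i 1) = a i) :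
    HasPD f x a :=
  ⟨h.differentiableAt, fun i => by rw [pd, h.fderiv, ha]⟩

lemma HasPD.mul {n : ℕ} {f g : (Fin n → ℝ) → ℝ} {x a b : Fin n → ℝ}
    (hf : HasPD f x a) (hg : HasPD g x b) :
    HasPD (fun y => f y * g y) x (fun i => a i * g x + f x * b i) := by
  refine HasPD.of (hf.1.hasFDerivAt.mul hg.1.hasFDerivAt) fun i => ?_
  have h1 := hf.2 i
  have h2 := hg.2 i
  simp only [pd] at h1 h2
  simp [h1, h2]
  ring

lemma HasPD.add {n : ℕ} {f g : (Fin n → ℝ) → ℝ} {x a b : Fin n → ℝ}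
    (hf : HasPD f x a) (hg : HasPD g x b) :
    HasPD (fun y => f y + g y) x (fun i => a i + b i) := by
  refine HasPD.of (hf.1.hasFDerivAt.add hg.1.hasFDerivAt) fun i => ?_
  have h1 := hf.2 i
  have h2 := hg.2 i
  simp only [pd] at h1 h2
  simp [h1, h2]

lemma HasPD.sum {n m : ℕ} {f : Fin m → (Fin n → ℝ) → ℝ} {x : Fin n → ℝ} {a : Fin m → Fin n → ℝ}
    (hf : ∀ k, HasPD (f k) x (a k)) :
    HasPD (fun y => ∑ k, f k y) x (fun i => ∑ k, a k i) := by
  refine HasPD.of (HasFDerivAt.fun_sum fun k _ => (hf k).1.hasFDerivAt) fun i => ?_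
  have h1 := fun k => (hf k).2 i
  simp only [pd] at h1
  simp [h1]

lemma HasPD.const {n : ℕ} (x : Fin n → ℝ) (c : ℝ) : HasPD (fun _ => c) x (fun _ => 0) :=
  HasPD.of (hasFDerivAt_const c x) fun i => by simp

lemma HasPD.coord {n : ℕ} (x : Fin n → ℝ) (k : Fin n) :
    HasPD (fun y => y k) x (fun i => (Pi.single i 1 : Fin n → ℝ) k) :=
  HasPD.of (hasFDerivAt_apply k x) fun i => by simp

lemma HasPD.scomp {n : ℕ} {g : (Fin n → ℝ) → ℝ} {x a : Fin n → ℝ} {G : ℝ → ℝ}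
    (hg : HasPD g x a) (hG : DifferentiableAt ℝ G (g x)) :
    HasPD (fun y => G (g y)) x (fun i => deriv G (g x) * a i) := by
  refine HasPD.of (hG.hasDerivAt.comp_hasFDerivAt x hg.1.hasFDerivAt) fun i => ?_
  have h1 := hg.2 i
  simp only [pd] at h1
  simp [h1]

lemma HasPD.comp {n m : ℕ} {U : Fin m → (Fin n → ℝ) → ℝ} {x : Fin n → ℝ} {a : Fin m → Fin n → ℝ}
    {ψ : (Fin m → ℝ) → ℝ} (hU : ∀ k, HasPD (U k) x (a k))
    (hψ : DifferentiableAt ℝ ψ (fun k => U k x)) :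
    HasPD (fun y => ψ (fun k => U k y)) x
      (fun i => ∑ k, pd k ψ (fun k => U k x) * a k i) := by
  have hUU : HasFDerivAt (fun y k => U k y) _ x :=
    hasFDerivAt_pi.2 fun k => (hU k).1.hasFDerivAt
  refine HasPD.of (HasFDerivAt.comp x hψ.hasFDerivAt hUU) fun i => ?_
  have h1 := fun k => (hU k).2 i
  simp only [pd] at h1
  simp only [ContinuousLinearMap.comp_apply, pd]
  rw [show (ContinuousLinearMap.pi fun k => fderiv ℝ (U k) x) (Pi.single i 1)
    = ∑ k, a k i • (Pi.single k 1 : Fin m → ℝ) by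
      ext k
      simp [h1, Pi.single_apply]]
  simp [map_sum, mul_comm]

lemma HasPD.congr {n : ℕ} {f g : (Fin n → ℝ) → ℝ} {x a b : Fin n → ℝ}
    (hf : HasPD f x a) (h : g =ᶠ[nhds x] f) (hab : ∀ i, a i = b i) : HasPD g x b :=
  ⟨hf.1.congr_of_eventuallyEq h, fun i => by rw [pd, h.fderiv_eq, ← hab]; exact hf.2 i⟩

/-- `x₀ ∂_j (x_{k+1}/x₀)`. -/
def cc {m : ℕ} (u : Fin m → ℝ) (k : Fin m) (j : Fin (m + 1)) : ℝ :=
  (Pi.single j 1 : Fin (m + 1) → ℝ) k.succ - u k * (Pi.single j 1 : Fin (m + 1) → ℝ) 0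

lemma HasPD.ratio {m : ℕ} (x : Fin (m + 1) → ℝ) (hx : x 0 ≠ 0) (k : Fin m) :
    HasPD (fun y : Fin (m + 1) → ℝ => y k.succ / y 0) x
      (fun i => cc (fun k => x k.succ / x 0) k i / x 0) := by
  have h0 : HasPD (fun y : Fin (m + 1) → ℝ => (y 0)⁻¹) x _ :=
    (HasPD.coord x 0).scomp (G := fun t => t⁻¹) (differentiableAt_inv hx)
  have h := (HasPD.coord x k.succ).mul h0
  refine h.congr (Filter.Eventually.of_forall fun y => by simp [div_eq_mul_inv]) fun i => ?_
  simp only [deriv_inv, cc]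
  field_simp
  ring

/-- Index equivalence. -/
noncomputable def ee (m : ℕ) : Unit ⊕ Fin m ≃ Fin (m + 1) :=
  Equiv.ofBijective (Sum.elim (fun _ => 0) Fin.succ) (by
    constructor
    · rintro (a | a) (b | b) h
      · rfl
      · exact absurd h.symm (Fin.succ_ne_zero b)
      · exact absurd h (Fin.succ_ne_zero a)
      · simpa using h
    · intro j
      refine Fin.cases ⟨Sum.inl (), rfl⟩ (fun k => ⟨Sum.inr k, rfl⟩) j)

lemma ee_inl (m : ℕ) (a : Unit) : ee m (Sum.inl a) = 0 := rfl

lemma ee_inr (m : ℕ) (k : Fin m) : ee m (Sum.inr k) = k.succ := rfl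

lemma det_alg {m : ℕ} (u p : Fin m → ℝ) (H : Matrix (Fin m) (Fin m) ℝ) (c s t : ℝ)
    (M : Matrix (Fin (m + 1)) (Fin (m + 1)) ℝ)
    (a : Fin (m + 1) → ℝ)
    (ha : ∀ j, a j = (Pi.single j 1 : Fin (m + 1) → ℝ) 0 * c + ∑ k, p k * cc u k j)
    (hM : ∀ i j, M i j = s * a i * a j + t * ∑ k, ∑ l, cc u l i * H l k * cc u k j) :
    M.det = c ^ 2 * t ^ m * s * H.det := by
  let B : Matrix (Unit ⊕ Fin m) (Unit ⊕ Fin m) ℝ :=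
    Matrix.fromBlocks (Matrix.of fun _ _ => c - ∑ k, p k * u k) (Matrix.of fun _ k => p k)
      (Matrix.of fun k _ => - u k) 1
  let D : Matrix (Unit ⊕ Fin m) (Unit ⊕ Fin m) ℝ :=
    Matrix.fromBlocks (Matrix.of fun _ _ => s) 0 0 (t • H)
  have hB1 : ∀ j, B (Sum.inl ()) j = a (ee m j) := by
    rintro (j | j)
    · simp [B, ha, ee_inl, ee_inr, cc, Pi.single_apply, Fin.succ_ne_zero, sub_eq_add_neg]
    · simp [B, ha, ee_inl, ee_inr, cc, Pi.single_apply, (Fin.succ_ne_zero _).symm]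
  have hB2 : ∀ k j, B (Sum.inr k) j = cc u k (ee m j) := by
    rintro k (j | j)
    · simp [B, ee_inl, ee_inr, cc, Pi.single_apply, Fin.succ_ne_zero]
    · simp [B, ee_inl, ee_inr, cc, Pi.single_apply, (Fin.succ_ne_zero _).symm, Matrix.one_apply]
  have hfac : M.submatrix (ee m) (ee m) = B.transpose * D * B := by
    ext i j
    simp only [Matrix.submatrix_apply, hM, Matrix.mul_apply, Matrix.transpose_apply,
      Fintype.sum_sum_type, hB1, hB2, D]
    simp [Finset.mul_sum, Finset.sum_mul]
    congr 1
    · ring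
    · refine Finset.sum_congr rfl fun k _ => Finset.sum_congr rfl fun l _ => by ring
  have hdB : B.det = c := by
    simp only [B, Matrix.det_fromBlocks_one₂₂]
    simp [Matrix.det_unique, Matrix.mul_apply]
  have hdD : D.det = s * (t ^ m * H.det) := by
    simp only [D, Matrix.det_fromBlocks_zero₂₁, Matrix.det_smul]
    simp [Matrix.det_unique]
  rw [← Matrix.det_submatrix_equiv_self (ee m) M, hfac, Matrix.det_mul, Matrix.det_mul,
    Matrix.det_transpose, hdB, hdD]
  ring

lemma isOpen_posOrth (n : ℕ) : IsOpen (posOrth n) := by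
  have : posOrth n = ⋂ i, {x | 0 < x i} := by ext; simp [posOrth]
  rw [this]
  exact isOpen_iInter_of_finite fun i => isOpen_lt continuous_const (continuous_apply i)

lemma first_pd {m : ℕ} (φ : (Fin m → ℝ) → ℝ)
    (hφC2 : ContDiffOn ℝ 2 φ (posOrth m))
    (hφpos : ∀ u ∈ posOrth m, 0 < φ u)
    (F : ℝ → ℝ) (hFC2 : ContDiffOn ℝ 2 F (Set.Ioi (0 : ℝ)))
    (x : Fin (m + 1) → ℝ) (hx : x ∈ posOrth (m + 1)) :
    HasPD (fun y => y 0 * φ (fun i => y i.succ / y 0)) x (fun j =>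
      (Pi.single j 1 : Fin (m + 1) → ℝ) 0 * φ (fun i => x i.succ / x 0) +
        ∑ k, pd k φ (fun i => x i.succ / x 0) * cc (fun i => x i.succ / x 0) k j) ∧
    HasPD (fun y => F (y 0 * φ (fun i => y i.succ / y 0))) x (fun j =>
      deriv F (x 0 * φ (fun i => x i.succ / x 0)) *
      ((Pi.single j 1 : Fin (m + 1) → ℝ) 0 * φ (fun i => x i.succ / x 0) +
        ∑ k, pd k φ (fun i => x i.succ / x 0) * cc (fun i => x i.succ / x 0) k j)) := by
  have hx0 : 0 < x 0 := hx 0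
  have hu : (fun i : Fin m => x i.succ / x 0) ∈ posOrth m := fun i => div_pos (hx _) hx0
  have hφd : DifferentiableAt ℝ φ (fun i : Fin m => x i.succ / x 0) :=
    (hφC2.contDiffAt ((isOpen_posOrth m).mem_nhds hu)).differentiableAt (by norm_num)
  have hw : 0 < x 0 * φ (fun i : Fin m => x i.succ / x 0) := mul_pos hx0 (hφpos _ hu)
  have hFd : DifferentiableAt ℝ F (x 0 * φ (fun i : Fin m => x i.succ / x 0)) :=
    (hFC2.contDiffAt (isOpen_Ioi.mem_nhds hw)).differentiableAt (by norm_num)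
  have h1 : HasPD (fun y => y 0 * φ (fun i => y i.succ / y 0)) x (fun j =>
      (Pi.single j 1 : Fin (m + 1) → ℝ) 0 * φ (fun i => x i.succ / x 0) +
        ∑ k, pd k φ (fun i => x i.succ / x 0) * cc (fun i => x i.succ / x 0) k j) := by
    refine ((HasPD.coord x 0).mul (HasPD.comp (fun k => HasPD.ratio x hx0.ne' k) hφd)).congr
      Filter.EventuallyEq.rfl fun i => ?_
    rw [Finset.mul_sum]
    congr 1
    refine Finset.sum_congr rfl fun k _ => ?_
    field_simp
  exact ⟨h1, h1.scomp hFd⟩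

/-- For `n = m + 1 ≥ 3`, a C² function `φ : ℝ^{n−1}₊ → ℝ₊`, and a C²
function `F : ℝ₊ → ℝ`, the function `f(x₁,…,xₙ) = F(x₁·φ(x₂/x₁,…,xₙ/x₁))` satisfies,
at every `x ∈ ℝⁿ₊` with `u = (x₂/x₁,…,xₙ/x₁)` and `w = x₁·φ(u)`:
`x₁^{n−1}·det(f_ij)(x) = φ(u)²·(F′(w))^{n−1}·F″(w)·det(φ_ij)(u)`. -/
theorem stmt_17 {m : ℕ} (hm : 3 ≤ m + 1)
    (φ : (Fin m → ℝ) → ℝ)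
    (hφC2 : ContDiffOn ℝ 2 φ (posOrth m))
    (hφpos : ∀ u ∈ posOrth m, 0 < φ u)
    (F : ℝ → ℝ) (hFC2 : ContDiffOn ℝ 2 F (Set.Ioi (0 : ℝ))) :
    ∀ x ∈ posOrth (m + 1),
      x 0 ^ m * hessDet (fun y => F (y 0 * φ (fun i => y i.succ / y 0))) x =
        (φ (fun i => x i.succ / x 0)) ^ 2 *
          (deriv F (x 0 * φ (fun i => x i.succ / x 0))) ^ m *
          deriv (deriv F) (x 0 * φ (fun i => x i.succ / x 0)) *
          hessDet φ (fun i => x i.succ / x 0) := by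
  intro x hx
  have hx0 : 0 < x 0 := hx 0
  have hu : (fun i : Fin m => x i.succ / x 0) ∈ posOrth m := fun i => div_pos (hx _) hx0
  have hφd : ∀ k, DifferentiableAt ℝ (pd k φ) (fun i : Fin m => x i.succ / x 0) := fun k => by
    have h := (hφC2.contDiffAt ((isOpen_posOrth m).mem_nhds hu)).fderiv_right
      (m := 1) (by norm_num)
    exact (h.differentiableAt (by norm_num)).clm_apply (differentiableAt_const _)
  have hφd0 : DifferentiableAt ℝ φ (fun i : Fin m => x i.succ / x 0) :=
    (hφC2.contDiffAt ((isOpen_posOrth m).mem_nhds hu)).differentiableAt (by norm_num)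
  have hw : 0 < x 0 * φ (fun i : Fin m => x i.succ / x 0) := mul_pos hx0 (hφpos _ hu)
  have hFd : DifferentiableAt ℝ (deriv F) (x 0 * φ (fun i : Fin m => x i.succ / x 0)) := by
    have h := (hFC2.contDiffAt (isOpen_Ioi.mem_nhds hw)).fderiv_right (m := 1) (by norm_num)
    exact (h.differentiableAt (by norm_num)).clm_apply (differentiableAt_const _)
  have hg := (first_pd φ hφC2 hφpos F hFC2 x hx).1
  have hdet := det_alg (fun i => x i.succ / x 0) (fun k => pd k φ (fun i => x i.succ / x 0))
    (hess φ (fun i => x i.succ / x 0)) (φ (fun i => x i.succ / x 0))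
    (deriv (deriv F) (x 0 * φ (fun i => x i.succ / x 0)))
    (deriv F (x 0 * φ (fun i => x i.succ / x 0)) / x 0)
    (hess (fun y => F (y 0 * φ (fun i => y i.succ / y 0))) x) _ (fun _ => rfl) (by
      intro i j
      have hev : pd j (fun y => F (y 0 * φ (fun i => y i.succ / y 0))) =ᶠ[nhds x]
          (fun y => deriv F (y 0 * φ (fun i => y i.succ / y 0)) *
        ((Pi.single j 1 : Fin (m + 1) → ℝ) 0 * φ (fun i => y i.succ / y 0) +
          ∑ k, pd k φ (fun i => y i.succ / y 0) *
            ((Pi.single j 1 : Fin (m + 1) → ℝ) k.succ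
              + y k.succ / y 0 * (-(Pi.single j 1 : Fin (m + 1) → ℝ) 0)))) := by
        filter_upwards [(isOpen_posOrth (m + 1)).mem_nhds hx] with y hy
        rw [(first_pd φ hφC2 hφpos F hFC2 y hy).2.2 j]
        simp only [cc, sub_eq_add_neg, mul_neg]
      have hr := fun k => HasPD.ratio x hx0.ne' k
      have h2 := (hg.scomp hFd).mul
        (((HasPD.const x ((Pi.single j 1 : Fin (m + 1) → ℝ) 0)).mul (HasPD.comp hr hφd0)).add
        (HasPD.sum fun k => (HasPD.comp hr (hφd k)).mul
          ((HasPD.const x ((Pi.single j 1 : Fin (m + 1) → ℝ) k.succ)).add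
            ((hr k).mul (HasPD.const x (-(Pi.single j 1 : Fin (m + 1) → ℝ) 0))))))
      refine ((h2.congr hev fun _ => rfl).2 i).trans ?_
      beta_reduce
      have hc : ∀ k, (Pi.single j 1 : Fin (m + 1) → ℝ) k.succ
            + x k.succ / x 0 * (-(Pi.single j 1 : Fin (m + 1) → ℝ) 0)
          = cc (fun i => x i.succ / x 0) k j := fun k => by simp only [cc]; ring
      simp only [hc]
      congr 1
      rw [div_mul_eq_mul_div, mul_div_assoc]
      congr 1
      simp only [zero_mul, zero_add, mul_zero, add_zero]
      rw [Finset.mul_sum, ← Finset.sum_add_distrib, Finset.sum_div]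
      refine Finset.sum_congr rfl fun k _ => ?_
      rw [Finset.sum_mul, Finset.sum_div]
      have hl : ∀ A B C : ℝ, A + B = 0 → A + (C + B) = C := fun A B C h => by linarith
      rw [hl _ _ _ (by ring)]
      refine Finset.sum_congr rfl fun l _ => ?_
      simp only [hess]
      ring)
  simp only [hessDet]
  have hne : x 0 ^ m ≠ 0 := pow_ne_zero _ hx0.ne'
  rw [hdet, div_pow]
  field_simp
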